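/- For every c ∈ (0,1] there exists α_*(c) ∈ (0,1) with the following property. Let α ∈ (0, α_*(c)], let Ω ⊂ ℝ² be a regular domain that is (α,c)-sandwiched, let μ ∈ (0, (1+α²)²/2], and let u ∈ C²(Ω) ∩ C⁰(cl Ω) solve −Δu = μ e^u in Ω with u = 0 on ∂Ω and 0 ≤ u ≤ v_{α,γ⁺(α,μ)} in Ω. Then there exists ν > 0 such that for every φ ∈ C_c^∞(Ω), ∫_Ω |∇φ|² − μ ∫_Ω e^u φ² ≥ ν ∫_Ω e^u φ². In particular, the first eigenvalue of the linearized operator −Δ − μ e^u with Dirichlet boundary conditions is strictly positive. -/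

import Mathlib

open MeasureTheory Real Set Filter

noncomputable section

/-- The Euclidean plane ℝ². -/
abbrev R2 : Type := EuclideanSpace ℝ (Fin 2)

/-- The Laplacian of `u : R2 → ℝ`: the sum of the second derivatives of `u`
along the two coordinate axes. -/
def lap (u : R2 → ℝ) (p : R2) : ℝ :=
  ∑ i : Fin 2, iteratedDeriv 2 (fun t : ℝ => u (p + t • EuclideanSpace.single i (1 : ℝ))) 0

/-- A simple domain: a bounded open simply connected set whose boundary is the support of a
simple rectifiable (i.e. of bounded variation) Jordan curve. -/
def IsSimpleDomain (Ω : Set R2) : Prop :=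
  IsOpen Ω ∧ Bornology.IsBounded Ω ∧ SimplyConnectedSpace Ω ∧
    ∃ γ : ℝ → R2, ContinuousOn γ (Icc 0 1) ∧ γ 0 = γ 1 ∧ InjOn γ (Ico 0 1) ∧
      γ '' Icc 0 1 = frontier Ω ∧ BoundedVariationOn γ (Icc 0 1)

/-- Identification of `R2` with `ℂ`. -/
def toC (p : R2) : ℂ := (p 0 : ℂ) + (p 1 : ℂ) * Complex.I

/-- A regular domain: a simple domain whose boundary is a continuous piecewise `C²` Jordan
curve with bounded derivative, having at most finitely many corner points: at each corner the
one-sided limiting tangent vectors exist, are nonzero and non-parallel (so that the inner angle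
is well defined and lies in `(0, 2π) \ {π}`), and each corner admits a conformal bijection of a
neighborhood mapping the boundary onto a `C²` curve. -/
def IsRegularDomain (Ω : Set R2) : Prop :=
  IsSimpleDomain Ω ∧
    ∃ (γ : ℝ → R2) (m : ℕ) (t : Fin m → ℝ) (C : ℝ),
      ContinuousOn γ (Icc 0 1) ∧ γ 0 = γ 1 ∧ InjOn γ (Ico 0 1) ∧
      γ '' Icc 0 1 = frontier Ω ∧
      StrictMono t ∧ (∀ i, t i ∈ Ico (0 : ℝ) 1) ∧
      (∀ s ∈ Icc (0 : ℝ) 1, (∀ i, s ≠ t i) →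
        ContDiffWithinAt ℝ 2 γ (Icc 0 1) s ∧ ‖derivWithin γ (Icc 0 1) s‖ ≤ C) ∧
      (∀ i : Fin m, ∃ vm vp : R2, vm ≠ 0 ∧ vp ≠ 0 ∧
        Filter.Tendsto (fun s => (s - t i)⁻¹ • (γ s - γ (t i)))
          (nhdsWithin (t i) (Iio (t i))) (nhds vm) ∧
        Filter.Tendsto (fun s => (s - t i)⁻¹ • (γ s - γ (t i)))
          (nhdsWithin (t i) (Ioi (t i))) (nhds vp) ∧
        (∀ r : ℝ, vp ≠ r • vm)) ∧
      (∀ i : Fin m, ∃ (U : Set ℂ) (f : ℂ → ℂ) (η : ℝ → ℂ),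
        IsOpen U ∧ toC (γ (t i)) ∈ U ∧ DifferentiableOn ℂ f U ∧ InjOn f U ∧
        ContDiff ℝ 2 η ∧ f '' (U ∩ toC '' frontier Ω) ⊆ Set.range η)

/-- The closed ellipse `E_α(β) = {α²x² + y² ≤ β²}`. -/
def EllipseSet (α β : ℝ) : Set R2 := {p | α ^ 2 * p 0 ^ 2 + p 1 ^ 2 ≤ β ^ 2}

/-- `Ω` is `(α,c)`-sandwiched: `E_α(β₋) ⊆ Ω ⊆ E_α(β₊)` with `c = β₋²/β₊²`. -/
def Sandwiched (α c : ℝ) (Ω : Set R2) : Prop :=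
  ∃ βm βp : ℝ, 0 < βm ∧ βm ≤ βp ∧ c = βm ^ 2 / βp ^ 2 ∧
    EllipseSet α βm ⊆ Ω ∧ Ω ⊆ EllipseSet α βp

/-- `v_{α,γ}(x,y) = 2 log((1+γ²)/(1+γ²(α²x²+y²)))`. -/
def vag (α γ : ℝ) (p : R2) : ℝ :=
  2 * Real.log ((1 + γ ^ 2) / (1 + γ ^ 2 * (α ^ 2 * p 0 ^ 2 + p 1 ^ 2)))

/-- `γ⁺(α,μ)²`. -/
def gammaPlusSq (α μ : ℝ) : ℝ :=
  (2 * (1 + α ^ 2) - μ - 2 * Real.sqrt ((1 + α ^ 2) ^ 2 - 2 * μ)) / (μ + 4 * (1 - α ^ 2))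

/-- `γ⁺(α,μ)`. -/
def gammaPlus (α μ : ℝ) : ℝ := Real.sqrt (gammaPlusSq α μ)

/-- `φ ∈ C_c^∞(Ω)`. -/
def IsTestFun (Ω : Set R2) (φ : R2 → ℝ) : Prop :=
  ContDiff ℝ (⊤ : ℕ∞) φ ∧ HasCompactSupport φ ∧ tsupport φ ⊆ Ω

/-- The integral of a directional derivative of a compactly supported `C¹` function vanishes. -/
theorem integral_fderiv_apply_eq_zero {F : R2 → ℝ} (hF : ContDiff ℝ 1 F)
    (hc : HasCompactSupport F) (v : R2) : ∫ p, fderiv ℝ F p v = 0 := by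
  have hint : Integrable (fun p => fderiv ℝ F p v) :=
    ((hF.continuous_fderiv one_ne_zero).clm_apply continuous_const).integrable_of_hasCompactSupport
      (hc.fderiv_apply ℝ v)
  have h := integral_mul_fderiv_eq_neg_fderiv_mul_of_integrable (μ := (volume : Measure R2))
    (f := fun _ => (1 : ℝ)) (g := F) (v := v) (by simp) (by simpa using hint)
    (by simpa using hF.continuous.integrable_of_hasCompactSupport hc)
    (fun _ _ => differentiableAt_const _) (fun p _ => hF.differentiable one_ne_zero p)
  simpa using h

theorem norm_gradient_eq_norm_fderiv (φ : R2 → ℝ) (p : R2) :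
    ‖gradient φ p‖ = ‖fderiv ℝ φ p‖ := by
  simp [gradient]

theorem integrable_norm_gradient_sq {φ : R2 → ℝ} (hφ : ContDiff ℝ 1 φ)
    (hc : HasCompactSupport φ) : Integrable (fun p => ‖gradient φ p‖ ^ 2) := by
  simp only [norm_gradient_eq_norm_fderiv]
  refine Continuous.integrable_of_hasCompactSupport
    ((hφ.continuous_fderiv one_ne_zero).norm.pow 2) ?_
  exact (hc.fderiv ℝ).comp_left (g := fun L : R2 →L[ℝ] ℝ => ‖L‖ ^ 2) (by simp)

theorem integrable_sq_of_hasCompactSupport {φ : R2 → ℝ} (hφ : Continuous φ)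
    (hc : HasCompactSupport φ) : Integrable (fun p => φ p ^ 2) := by
  have h : HasCompactSupport (fun p => φ p ^ 2) := by
    refine hc.mono fun p hp => ?_
    contrapose! hp
    simp_all
  exact (hφ.pow 2).integrable_of_hasCompactSupport h

/-- Poincaré inequality on the strip `|y| ≤ 1`, obtained from the positive function
`cos (κ y)` with `κ < π / 2`. -/
theorem sq_mul_integral_sq_le_of_tsupport_subset_strip {κ : ℝ} (hκ : 0 < κ) (hκπ : κ < π / 2)
    {φ : R2 → ℝ} (hφ : ContDiff ℝ 1 φ) (hc : HasCompactSupport φ)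
    (hs : ∀ p ∈ tsupport φ, |p 1| ≤ 1) :
    κ ^ 2 * ∫ p, φ p ^ 2 ≤ ∫ p, ‖gradient φ p‖ ^ 2 := by
  set e : R2 := EuclideanSpace.single 1 1 with he
  set F : R2 → ℝ := fun p => tan (κ * p 1) * φ p ^ 2 with hF
  have hcos : ∀ p ∈ tsupport φ, 0 < cos (κ * p 1) := by
    intro p hp
    have h := abs_le.1 (hs p hp)
    refine cos_pos_of_mem_Ioo ⟨?_, ?_⟩ <;> nlinarith
  have hzero : ∀ p ∉ tsupport φ, F =ᶠ[nhds p] fun _ => 0 := by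
    intro p hp
    filter_upwards [notMem_tsupport_iff_eventuallyEq.1 hp] with q hq
    simp [hF, hq]
  have hF1 : ContDiff ℝ 1 F := by
    refine contDiff_iff_contDiffAt.2 fun p => ?_
    by_cases hp : p ∈ tsupport φ
    · have h1 : ContDiffAt ℝ 1 (fun q : R2 => κ * q 1) p := by fun_prop
      exact (ContDiffAt.comp p (contDiffAt_tan.2 (hcos p hp).ne') h1).mul
        (hφ.contDiffAt.pow 2)
    · exact contDiffAt_const.congr_of_eventuallyEq (hzero p hp)
  have hFc : HasCompactSupport F := by
    refine hc.mono fun p hp => ?_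
    contrapose! hp
    simp_all
  have hFint : Integrable (fun p => fderiv ℝ F p e) :=
    ((hF1.continuous_fderiv one_ne_zero).clm_apply continuous_const).integrable_of_hasCompactSupport
      (hFc.fderiv_apply ℝ e)
  have hφint : Integrable (fun p => φ p ^ 2) :=
    integrable_sq_of_hasCompactSupport hφ.continuous hc
  have hpt : ∀ p, κ ^ 2 * φ p ^ 2 - κ * fderiv ℝ F p e ≤ ‖gradient φ p‖ ^ 2 := by
    intro p
    by_cases hp : p ∈ tsupport φ
    · have hd : fderiv ℝ F p e = κ * (1 + tan (κ * p 1) ^ 2) * φ p ^ 2 +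
          tan (κ * p 1) * (2 * φ p * fderiv ℝ φ p e) := by
        have h1 : HasFDerivAt (fun q : R2 => κ * q 1)
            (κ • (EuclideanSpace.proj 1 : R2 →L[ℝ] ℝ)) p :=
          (EuclideanSpace.proj 1 : R2 →L[ℝ] ℝ).hasFDerivAt.const_mul κ
        have h2 := (hasDerivAt_tan (hcos p hp).ne').comp_hasFDerivAt p h1
        have h3 := (hφ.differentiable one_ne_zero p).hasFDerivAt.pow 2
        have h4 := (h2.mul h3).fderiv
        have h5 : fderiv ℝ F p e = _ := congrArg (fun L : R2 →L[ℝ] ℝ => L e) h4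
        rw [h5]
        have h6 : 1 / cos (κ * p 1) ^ 2 = 1 + tan (κ * p 1) ^ 2 := by
          have := (hcos p hp).ne'
          rw [tan_eq_sin_div_cos]
          field_simp
          linarith [sin_sq_add_cos_sq (κ * p 1)]
        rw [h6]
        simp [he]
        ring
      have hn : |fderiv ℝ φ p e| ≤ ‖gradient φ p‖ := by
        rw [norm_gradient_eq_norm_fderiv]
        simpa [he] using (fderiv ℝ φ p).le_opNorm e
      have hn2 := sq_le_sq' (by linarith [abs_nonneg (fderiv ℝ φ p e)]) hn
      rw [sq_abs] at hn2
      rw [hd]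
      nlinarith [sq_nonneg (fderiv ℝ φ p e + κ * tan (κ * p 1) * φ p)]
    · have h0 : φ p = 0 := image_eq_zero_of_notMem_tsupport hp
      rw [(hzero p hp).fderiv_eq]
      simp [h0]
  have hmono := integral_mono ((hφint.const_mul (κ ^ 2)).sub (hFint.const_mul κ))
    (integrable_norm_gradient_sq hφ hc) hpt
  simp only [Pi.sub_apply] at hmono
  rw [integral_sub (hφint.const_mul _) (hFint.const_mul _), integral_const_mul,
    integral_const_mul, integral_fderiv_apply_eq_zero hF1 hFc] at hmono
  linarith

theorem gammaPlusSq_pos {α μ : ℝ} (hα : 0 < α) (hα1 : α < 1)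
    (hμ : 0 < μ) (hμ' : μ ≤ (1 + α ^ 2) ^ 2 / 2) : 0 < gammaPlusSq α μ := by
  have hα2 : α ^ 2 < 1 := by nlinarith
  have hα0 : 0 < α ^ 2 := by positivity
  have hs : √((1 + α ^ 2) ^ 2 - 2 * μ) < (2 * (1 + α ^ 2) - μ) / 2 := by
    rw [Real.sqrt_lt' (by nlinarith)]
    nlinarith
  exact div_pos (by linarith) (by linarith)

theorem one_add_gammaPlusSq_le {α μ : ℝ} (hα : α ^ 2 < 1) (hμ : 0 < μ) :
    1 + gammaPlusSq α μ ≤ 3 / (2 * (1 - α ^ 2)) := by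
  have hd : 0 < μ + 4 * (1 - α ^ 2) := by linarith
  have hs := Real.sqrt_nonneg ((1 + α ^ 2) ^ 2 - 2 * μ)
  have h1 : 1 + gammaPlusSq α μ ≤ 6 / (μ + 4 * (1 - α ^ 2)) := by
    rw [gammaPlusSq, one_add_div hd.ne']
    gcongr
    nlinarith [sq_nonneg α]
  refine h1.trans ?_
  rw [div_le_div_iff₀ hd (by linarith)]
  nlinarith

theorem abs_coord_le_one_of_vag_nonneg {α γ : ℝ} (hγ : 0 < γ) {p : R2}
    (h : 0 ≤ vag α γ p) : |p 1| ≤ 1 := by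
  have hden : 0 < 1 + γ ^ 2 * (α ^ 2 * p 0 ^ 2 + p 1 ^ 2) := by positivity
  have h1 : 1 ≤ (1 + γ ^ 2) / (1 + γ ^ 2 * (α ^ 2 * p 0 ^ 2 + p 1 ^ 2)) :=
    (Real.log_nonneg_iff (by positivity)).1 (by unfold vag at h; linarith)
  rw [le_div_iff₀ hden] at h1
  have h2 : γ ^ 2 * (α ^ 2 * p 0 ^ 2 + p 1 ^ 2) ≤ γ ^ 2 * 1 := by linarith
  have h3 := le_of_mul_le_mul_left h2 (by positivity)
  exact abs_le_one_iff_mul_self_le_one.2 (by nlinarith [sq_nonneg (α * p 0)])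

theorem exp_vag_le (α γ : ℝ) (p : R2) : exp (vag α γ p) ≤ (1 + γ ^ 2) ^ 2 := by
  have hden : 1 ≤ 1 + γ ^ 2 * (α ^ 2 * p 0 ^ 2 + p 1 ^ 2) := by
    have : 0 ≤ γ ^ 2 * (α ^ 2 * p 0 ^ 2 + p 1 ^ 2) := by positivity
    linarith
  have h1 : (0 : ℝ) < (1 + γ ^ 2) / (1 + γ ^ 2 * (α ^ 2 * p 0 ^ 2 + p 1 ^ 2)) := by positivity
  rw [vag, two_mul, exp_add, exp_log h1, ← sq]
  exact pow_le_pow_left₀ h1.le (div_le_self (by positivity) hden) 2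

/-- Positivity of the first eigenvalue of the linearized operator `−Δ − μ eᵘ` at the
sub-supersolution solutions of `Q(μ,Ω)` on thin sandwiched regular domains. -/
theorem statement7 :
    ∀ c ∈ Set.Ioc (0 : ℝ) 1, ∃ αs ∈ Set.Ioo (0 : ℝ) 1,
      ∀ α ∈ Set.Ioc (0 : ℝ) αs, ∀ Ω : Set R2, IsRegularDomain Ω → Sandwiched α c Ω →
        ∀ μ ∈ Set.Ioc (0 : ℝ) ((1 + α ^ 2) ^ 2 / 2), ∀ u : R2 → ℝ,
          ContDiffOn ℝ 2 u Ω → ContinuousOn u (closure Ω) →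
          (∀ p ∈ Ω, -lap u p = μ * Real.exp (u p)) →
          (∀ p ∈ frontier Ω, u p = 0) →
          (∀ p ∈ Ω, 0 ≤ u p ∧ u p ≤ vag α (gammaPlus α μ) p) →
          ∃ ν : ℝ, 0 < ν ∧ ∀ φ : R2 → ℝ, IsTestFun Ω φ →
            ν * (∫ p in Ω, Real.exp (u p) * φ p ^ 2) ≤
              (∫ p in Ω, ‖gradient φ p‖ ^ 2) -
                μ * (∫ p in Ω, Real.exp (u p) * φ p ^ 2) := by
  intro c _
  refine ⟨1 / 10, by norm_num, ?_⟩
  rintro α ⟨hα, hα'⟩ Ω hΩ - μ ⟨hμ, hμ'⟩ u - - - - hu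
  refine ⟨1 / 4, by norm_num, ?_⟩
  rintro φ ⟨hφ, hc, hs⟩
  have hα2 : α ^ 2 ≤ 1 / 100 := by nlinarith
  have hμ1 : μ ≤ 13 / 25 := by nlinarith [sq_nonneg α]
  have hpos := gammaPlusSq_pos hα (by linarith) hμ hμ'
  have hγ : 0 < gammaPlus α μ := Real.sqrt_pos.2 hpos
  have hγsq : 1 + gammaPlus α μ ^ 2 ≤ 50 / 33 := by
    rw [gammaPlus, Real.sq_sqrt hpos.le]
    refine (one_add_gammaPlusSq_le (by linarith) hμ).trans ?_
    rw [div_le_div_iff₀ (by linarith) (by norm_num)]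
    linarith
  have hexp : ∀ p ∈ Ω, exp (u p) ≤ (50 / 33) ^ 2 := fun p hp =>
    ((exp_le_exp.2 (hu p hp).2).trans (exp_vag_le _ _ p)).trans
      (pow_le_pow_left₀ (by positivity) hγsq 2)
  have hφ1 : ContDiff ℝ 1 φ := hφ.of_le (by norm_cast)
  have hP := sq_mul_integral_sq_le_of_tsupport_subset_strip (κ := 3 / 2) (by norm_num)
    (by linarith [pi_gt_three]) hφ1 hc fun p hp =>
      abs_coord_le_one_of_vag_nonneg hγ ((hu p (hs hp)).1.trans (hu p (hs hp)).2)
  have hφint : Integrable (fun p => φ p ^ 2) :=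
    integrable_sq_of_hasCompactSupport hφ.continuous hc
  have hle : ∫ p in Ω, exp (u p) * φ p ^ 2 ≤ (50 / 33) ^ 2 * ∫ p, φ p ^ 2 := by
    calc ∫ p in Ω, exp (u p) * φ p ^ 2 ≤ ∫ p in Ω, (50 / 33) ^ 2 * φ p ^ 2 := by
          refine integral_mono_of_nonneg (ae_of_all _ fun p => ?_)
            (hφint.const_mul _).integrableOn ?_
          · show 0 ≤ exp (u p) * φ p ^ 2
            positivity
          · filter_upwards [ae_restrict_mem hΩ.1.1.measurableSet] with p hp
            exact mul_le_mul_of_nonneg_right (hexp p hp) (sq_nonneg _)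
      _ = (50 / 33) ^ 2 * ∫ p, φ p ^ 2 := by
          rw [integral_const_mul, setIntegral_eq_integral_of_forall_compl_eq_zero]
          intro p hp
          simp [image_eq_zero_of_notMem_tsupport fun h => hp (hs h)]
  have hgrad : ∫ p in Ω, ‖gradient φ p‖ ^ 2 = ∫ p, ‖gradient φ p‖ ^ 2 := by
    refine setIntegral_eq_integral_of_forall_compl_eq_zero fun p hp => ?_
    have h0 := image_eq_zero_of_notMem_tsupport
      fun h => hp (hs (tsupport_fderiv_subset ℝ (f := φ) h))
    rw [norm_gradient_eq_norm_fderiv, h0]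
    simp
  have hI : 0 ≤ ∫ p, φ p ^ 2 := integral_nonneg fun p => sq_nonneg _
  have hJ : 0 ≤ ∫ p in Ω, exp (u p) * φ p ^ 2 := integral_nonneg fun p => by positivity
  rw [hgrad]
  nlinarith
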